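/- If G is a finite abelian group of order v and B₁,…,Bₙ is a (v,k,1)-difference family in G (i.e., each Bᵢ is a k-element subset of G and every nonzero element g of G has exactly one representation g = x − y with x, y ∈ Bᵢ for some index i), then the collection of all translates {Bᵢ + g : 1 ≤ i ≤ n, g ∈ G} forms a Steiner system S(2,k,v) on the point set G: every 2-element subset of G is contained in exactly one translate (counted as a pair (i,g) up to equality of the resulting block with multiplicity given by representations). -/

import Mathlib

theorem stmt_2 (G : Type) [AddCommGroup G] [Fintype G] [DecidableEq G]
    (v k n : ℕ) (hv : Fintype.card G = v)
    (B : Fin n → Finset G) (hk : ∀ i, (B i).card = k)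
    (hdiff : ∀ g : G, g ≠ 0 →
      ∃! t : Fin n × G × G, t.2.1 ∈ B t.1 ∧ t.2.2 ∈ B t.1 ∧ t.2.1 - t.2.2 = g) :
    ∀ p : Finset G, p.card = 2 →
      ∃! t : Fin n × G, p ⊆ (B t.1).image (fun x => x + t.2) := by
  intro p hp
  obtain ⟨a, b, hab, rfl⟩ := Finset.card_eq_two.mp hp
  obtain ⟨⟨i, x, y⟩, ⟨hx, hy, hxy⟩, huniq⟩ := hdiff (a - b) (sub_ne_zero.mpr hab)
  dsimp only at hx hy hxy
  refine ⟨(i, a - x), ?_, ?_⟩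
  · simp only [Finset.insert_subset_iff, Finset.singleton_subset_iff, Finset.mem_image]
    refine ⟨⟨x, hx, by abel⟩, y, hy, ?_⟩
    rw [← sub_sub_cancel a b, ← hxy]
    abel
  · rintro ⟨j, g⟩ h
    simp only [Finset.insert_subset_iff, Finset.singleton_subset_iff, Finset.mem_image] at h
    obtain ⟨⟨x', hx', rfl⟩, y', hy', rfl⟩ := h
    have h := huniq (j, x', y') ⟨hx', hy', (add_sub_add_right_eq_sub x' y' g).symm⟩
    simp only [Prod.mk.injEq] at h
    obtain ⟨rfl, rfl, -⟩ := h
    simp
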